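/- Conformal invariance of the conformal harmonic gauge condition (Proposition 2.6, coordinate version): Let n ≥ 3, k ∈ ℕ with k ≥ 2, and α ∈ (0,1). Let g be a metric of class C^{k+α} on an open set U ⊆ ℝⁿ and let c be a positive function of class C^{k+α} on U. Suppose f_g ∈ C²(U) is positive with L_g f_g = 0 on U and Γ_a(g) = 2 ∂_a (log f_g) on U for every a = 1, …, n. Define f_{cg} := c^{−(n−2)/4} f_g. Then f_{cg} > 0 on U, L_{cg} f_{cg} = 0 on U, and Γ_a(cg) = 2 ∂_a (log f_{cg}) on U for every a = 1, …, n, where cg is the pointwise rescaled metric x ↦ c(x) g(x). -/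

import Mathlib

noncomputable section

open Set Matrix Matrix

/-- Points of `ℝⁿ`. -/
abbrev Pt (n : ℕ) := Fin n → ℝ

/-- A metric in coordinates: a matrix-valued map. -/
abbrev Met (n : ℕ) := Pt n → Matrix (Fin n) (Fin n) ℝ

/-- Partial derivative of `f` in the `a`-th coordinate direction. -/
def pd {n : ℕ} (a : Fin n) (f : Pt n → ℝ) (x : Pt n) : ℝ :=
  fderiv ℝ f x (Pi.single a 1)

/-- `g` is a metric (pointwise symmetric positive definite) on `U`. -/
def IsMetricOn {n : ℕ} (g : Met n) (U : Set (Pt n)) : Prop :=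
  ∀ x ∈ U, (g x).IsSymm ∧ (g x).PosDef

/-- Christoffel symbols `Γ^c_{ab}` of `g`. -/
def christoffel {n : ℕ} (g : Met n) (c a b : Fin n) (x : Pt n) : ℝ :=
  (1 / 2) * ∑ d, (g x)⁻¹ c d *
    (pd a (fun y => g y b d) x + pd b (fun y => g y a d) x - pd d (fun y => g y a b) x)

/-- Ricci tensor `R_{ab}` of `g`. -/
def ricci {n : ℕ} (g : Met n) (a b : Fin n) (x : Pt n) : ℝ :=
  (∑ c, pd c (christoffel g c a b) x) - (∑ c, pd a (christoffel g c c b) x)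
    + (∑ c, ∑ d, christoffel g c a b x * christoffel g d d c x)
    - (∑ c, ∑ d, christoffel g d c b x * christoffel g c a d x)

/-- Scalar curvature `R(g)`. -/
def scalarCurv {n : ℕ} (g : Met n) (x : Pt n) : ℝ :=
  ∑ a, ∑ b, (g x)⁻¹ a b * ricci g a b x

/-- Laplace–Beltrami operator `Δ_g`. -/
def laplaceBeltrami {n : ℕ} (g : Met n) (u : Pt n → ℝ) (x : Pt n) : ℝ :=
  -(Real.sqrt (g x).det)⁻¹ *
    ∑ a, pd a (fun y => Real.sqrt (g y).det * ∑ b, (g y)⁻¹ a b * pd b u y) x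

/-- Conformal Laplacian `L_g`. -/
def confLap {n : ℕ} (g : Met n) (u : Pt n → ℝ) (x : Pt n) : ℝ :=
  laplaceBeltrami g u x + (((n : ℝ) - 2) / (4 * ((n : ℝ) - 1))) * scalarCurv g x * u x

/-- `f` is of class `C^{k+α}` on `s`: it is `C^k` there and its `k`-th order derivatives are
locally `α`-Hölder continuous. -/
def CHolderOn {n : ℕ} (k : ℕ) (α : ℝ) (s : Set (Pt n)) (f : Pt n → ℝ) : Prop :=
  ContDiffOn ℝ k f s ∧
    ∀ x ∈ s, ∃ C : NNReal, ∃ t ∈ nhdsWithin x s,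
      HolderOnWith C (Real.toNNReal α) (iteratedFDerivWithin ℝ k f s) t

/-- All entries of `g` are of class `C^{k+α}` on `s`. -/
def MetCHolderOn {n : ℕ} (k : ℕ) (α : ℝ) (s : Set (Pt n)) (g : Met n) : Prop :=
  ∀ a b, CHolderOn k α s fun x => g x a b

/-- Contracted Christoffel symbol `Γ^a = g^{bc} Γ^a_{bc}`. -/
def gammaUp {n : ℕ} (g : Met n) (a : Fin n) (x : Pt n) : ℝ :=
  ∑ b, ∑ c, (g x)⁻¹ b c * christoffel g a b c x

/-- Contracted Christoffel symbol `Γ_a = g_{ab} Γ^b`. -/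
def gammaLow {n : ℕ} (g : Met n) (a : Fin n) (x : Pt n) : ℝ :=
  ∑ b, g x a b * gammaUp g b x

/-- `g` satisfies the conformal harmonic gauge on `U`. -/
def ConfHarmonicGauge {n : ℕ} (g : Met n) (U : Set (Pt n)) : Prop :=
  ∃ f : Pt n → ℝ, ContDiffOn ℝ 2 f U ∧ (∀ x ∈ U, 0 < f x) ∧
    (∀ x ∈ U, confLap g f x = 0) ∧
    ∀ a : Fin n, ∀ x ∈ U, gammaLow g a x = 2 * pd a (fun y => Real.log (f y)) x

/-- Determinant-normalized metric `ĝ = (det g)^{-1/n} g`. -/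
def dnorm {n : ℕ} (g : Met n) : Met n :=
  fun x => ((g x).det ^ (-(1 : ℝ) / (n : ℝ))) • g x

/-- Jacobian matrix of a map `Z : ℝⁿ → ℝⁿ`. -/
def jac {n : ℕ} (Z : Pt n → Pt n) (x : Pt n) : Matrix (Fin n) (Fin n) ℝ :=
  Matrix.of fun i j => pd j (fun y => Z y i) x

/-- Riemann curvature tensor `R_{abc}{}^{d}`. -/
def riemannUp {n : ℕ} (g : Met n) (a b c d : Fin n) (x : Pt n) : ℝ :=
  pd a (christoffel g d b c) x - pd b (christoffel g d a c) x
    + (∑ e, christoffel g e b c x * christoffel g d a e x)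
    - (∑ e, christoffel g e a c x * christoffel g d b e x)

/-- Riemann curvature tensor `R_{abcd} = R_{abc}{}^{e} g_{ed}`. -/
def riemannLow {n : ℕ} (g : Met n) (a b c d : Fin n) (x : Pt n) : ℝ :=
  ∑ e, riemannUp g a b c e x * g x e d

/-- Schouten tensor `P_{ab}`. -/
def schouten {n : ℕ} (g : Met n) (a b : Fin n) (x : Pt n) : ℝ :=
  (1 / ((n : ℝ) - 2)) * (ricci g a b x - (scalarCurv g x / (2 * ((n : ℝ) - 1))) * g x a b)

/-- Weyl tensor `W_{abcd}`. -/
def weyl {n : ℕ} (g : Met n) (a b c d : Fin n) (x : Pt n) : ℝ :=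
  riemannLow g a b c d x + schouten g a c x * g x b d - schouten g b c x * g x a d
    + schouten g b d x * g x a c - schouten g a d x * g x b c

/-- Weyl tensor with raised last index, `W_{abc}{}^{d} = g^{de} W_{abce}`. -/
def weylUp {n : ℕ} (g : Met n) (a b c d : Fin n) (x : Pt n) : ℝ :=
  ∑ e, (g x)⁻¹ d e * weyl g a b c e x

/-- Covariant derivative of a 2-tensor: `(∇T)_{cab} = ∇_c T_{ab}`. -/
def cov2 {n : ℕ} (g : Met n) (T : Fin n → Fin n → Pt n → ℝ) (c a b : Fin n) (x : Pt n) : ℝ :=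
  pd c (T a b) x - (∑ d, christoffel g d c a x * T d b x)
    - ∑ d, christoffel g d c b x * T a d x

/-- Covariant derivative of a 3-tensor: `(∇T)_{dabc} = ∇_d T_{abc}`. -/
def cov3 {n : ℕ} (g : Met n) (T : Fin n → Fin n → Fin n → Pt n → ℝ) (d a b c : Fin n)
    (x : Pt n) : ℝ :=
  pd d (T a b c) x - (∑ e, christoffel g e d a x * T e b c x)
    - (∑ e, christoffel g e d b x * T a e c x)
    - ∑ e, christoffel g e d c x * T a b e x

/-- Cotton tensor `C_{abc} = ∇_a P_{bc} - ∇_b P_{ac}`. -/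
def cotton {n : ℕ} (g : Met n) (a b c : Fin n) (x : Pt n) : ℝ :=
  cov2 g (schouten g) a b c x - cov2 g (schouten g) b a c x

/-- Bach tensor `B_{ab}`. -/
def bach {n : ℕ} (g : Met n) (a b : Fin n) (x : Pt n) : ℝ :=
  (∑ c, ∑ d, (g x)⁻¹ c d *
      (cov3 g (cov2 g (schouten g)) d a b c x - cov3 g (cov2 g (schouten g)) d c a b x))
    + ∑ c, ∑ d, ∑ e, ∑ f, (g x)⁻¹ c e * (g x)⁻¹ d f * schouten g e f x * weyl g a c d b x

/-- The difference of the Christoffel symbols of `exp (2φ) g` and `g`, in terms of the differential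
`p` of `φ` and the gradient `ψ` of `φ`. -/
def confDiff {n : ℕ} (g : Matrix (Fin n) (Fin n) ℝ) (p ψ : Fin n → ℝ) (e a b : Fin n) : ℝ :=
  (if e = a then p b else 0) + (if e = b then p a else 0) - g a b * ψ e

section ConfDiff

variable {n : ℕ} {g : Matrix (Fin n) (Fin n) ℝ} {p ψ : Fin n → ℝ}

lemma confDiff_comm (hg : ∀ a b, g a b = g b a) (e a b : Fin n) :
    confDiff g p ψ e a b = confDiff g p ψ e b a := by
  simp only [confDiff, hg a b]
  ring

lemma sum_confDiff_mul (X : Fin n → ℝ) (a b : Fin n) :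
    ∑ c, confDiff g p ψ c a b * X c = p b * X a + p a * X b - g a b * ∑ c, ψ c * X c := by
  simp [confDiff, add_mul, sub_mul, Finset.sum_add_distrib, Finset.sum_sub_distrib,
    Finset.mul_sum, mul_assoc]

lemma sum_confDiff_self (hg : ∀ a b, g a b = g b a) (hψ : ∀ a, ∑ b, g a b * ψ b = p a)
    (b : Fin n) : ∑ c, confDiff g p ψ c c b = n * p b := by
  simp only [confDiff, Finset.sum_add_distrib, Finset.sum_sub_distrib, hg _ b, hψ]
  simp

lemma sum_sum_confDiff_mul (Y : Fin n → Fin n → ℝ) (b : Fin n) :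
    ∑ c, ∑ d, confDiff g p ψ d c b * Y c d
      = p b * ∑ c, Y c c + ∑ c, p c * Y c b - ∑ d, ψ d * ∑ c, g c b * Y c d := by
  simp only [confDiff, add_mul, sub_mul, Finset.sum_add_distrib, Finset.sum_sub_distrib,
    Finset.mul_sum]
  congr 1
  · simp
  · rw [Finset.sum_comm]
    exact Finset.sum_congr rfl fun _ _ => Finset.sum_congr rfl fun _ _ => by ring

lemma sum_confDiff_mul_confDiff (hg : ∀ a b, g a b = g b a)
    (hψ : ∀ a, ∑ b, g a b * ψ b = p a) (a b : Fin n) :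
    ∑ c, ∑ d, confDiff g p ψ d c b * confDiff g p ψ c a d
      = (n + 2) * (p a * p b) - 2 * (g a b * ∑ c, ψ c * p c) := by
  rw [sum_sum_confDiff_mul]
  have h1 : ∑ c, p c * confDiff g p ψ c a b = 2 * (p a * p b) - g a b * ∑ c, ψ c * p c := by
    simp_rw [mul_comm (p _) (confDiff _ _ _ _ _ _)]
    rw [sum_confDiff_mul]; ring
  have h2 (d : Fin n) : ψ d * ∑ c, g c b * confDiff g p ψ c a d
      = g a b * (ψ d * p d) + p a * (g b d * ψ d) - (g a d * ψ d) * p b := by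
    simp_rw [mul_comm (g _ b) (confDiff _ _ _ _ _ _)]
    rw [sum_confDiff_mul]
    have : ∑ c, ψ c * g c b = p b := by
      rw [← hψ b]; exact Finset.sum_congr rfl fun c _ => by rw [hg c b]; ring
    rw [this, hg d b]; ring
  have h3 : ∑ c, confDiff g p ψ c a c = n * p a := by
    rw [← sum_confDiff_self hg hψ a]
    exact Finset.sum_congr rfl fun c _ => confDiff_comm hg _ _ _
  simp_rw [h2, Finset.sum_sub_distrib, Finset.sum_add_distrib, ← Finset.mul_sum,
    ← Finset.sum_mul, hψ]
  rw [h1, h3]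
  ring

/-- The quadratic part of the conformal transformation law of the Ricci tensor. -/
lemma quadratic_ricci_confDiff (hg : ∀ a b, g a b = g b a) (hψ : ∀ a, ∑ b, g a b * ψ b = p a)
    {Γ : Fin n → Fin n → Fin n → ℝ} (hΓ : ∀ c a b, Γ c a b = Γ c b a)
    {dg : Fin n → Fin n → Fin n → ℝ}
    (hdg : ∀ d a b, ∑ c, g c b * Γ c a d + ∑ c, g c a * Γ c d b = dg d a b) (a b : Fin n) :
    ((∑ c, ∑ d, (Γ c a b + confDiff g p ψ c a b) * (Γ d d c + confDiff g p ψ d d c))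
      - ∑ c, ∑ d, (Γ d c b + confDiff g p ψ d c b) * (Γ c a d + confDiff g p ψ c a d))
    = (∑ c, ∑ d, Γ c a b * Γ d d c) - (∑ c, ∑ d, Γ d c b * Γ c a d)
      + (n - 2) * ∑ c, Γ c a b * p c + (n - 2) * (p a * p b)
      - (n - 2) * (g a b * ∑ c, ψ c * p c)
      - g a b * (∑ c, ψ c * ∑ d, Γ d d c) + ∑ d, dg d a b * ψ d := by
  have hT := sum_confDiff_self hg hψ
  have e1 : ∑ c, ∑ d, (Γ c a b + confDiff g p ψ c a b) * (Γ d d c + confDiff g p ψ d d c)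
      = (∑ c, ∑ d, Γ c a b * Γ d d c) + n * (∑ c, Γ c a b * p c)
        + (p b * (∑ d, Γ d d a) + p a * (∑ d, Γ d d b) - g a b * ∑ c, ψ c * ∑ d, Γ d d c)
        + n * (2 * (p a * p b) - g a b * ∑ c, ψ c * p c) := by
    have : ∀ c, ∑ d, (Γ c a b + confDiff g p ψ c a b) * (Γ d d c + confDiff g p ψ d d c)
        = (∑ d, Γ c a b * Γ d d c) + n * (Γ c a b * p c)
          + confDiff g p ψ c a b * (∑ d, Γ d d c) + n * (confDiff g p ψ c a b * p c) := by
      intro c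
      rw [← Finset.mul_sum, ← Finset.mul_sum, Finset.sum_add_distrib, hT]
      ring
    simp_rw [this, Finset.sum_add_distrib, ← Finset.mul_sum, sum_confDiff_mul]
    ring
  have e2 : ∑ c, ∑ d, (Γ d c b + confDiff g p ψ d c b) * (Γ c a d + confDiff g p ψ c a d)
      = (∑ c, ∑ d, Γ d c b * Γ c a d)
        + (p a * (∑ d, Γ d d b) + (∑ d, p d * Γ d a b) - ∑ c, ψ c * ∑ d, g d a * Γ d c b)
        + (p b * (∑ c, Γ c a c) + (∑ c, p c * Γ c a b) - ∑ d, ψ d * ∑ c, g c b * Γ c a d)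
        + ((n + 2) * (p a * p b) - 2 * (g a b * ∑ c, ψ c * p c)) := by
    have h : ∑ c, ∑ d, Γ d c b * confDiff g p ψ c a d
        = p a * (∑ d, Γ d d b) + (∑ d, p d * Γ d a b) - ∑ c, ψ c * ∑ d, g d a * Γ d c b := by
      rw [← sum_sum_confDiff_mul (fun d c => Γ d c b) a, Finset.sum_comm]
      exact Finset.sum_congr rfl fun _ _ => Finset.sum_congr rfl fun _ _ => by
        rw [confDiff_comm hg]; ring
    rw [← h, ← sum_sum_confDiff_mul (fun c d => Γ c a d) b, ← sum_confDiff_mul_confDiff hg hψ]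
    simp_rw [← Finset.sum_add_distrib]
    exact Finset.sum_congr rfl fun _ _ => Finset.sum_congr rfl fun _ _ => by ring
  have e3 : ∑ d, dg d a b * ψ d
      = (∑ d, ψ d * ∑ c, g c b * Γ c a d) + ∑ c, ψ c * ∑ d, g d a * Γ d c b := by
    rw [← Finset.sum_add_distrib]
    exact Finset.sum_congr rfl fun d _ => by rw [← hdg d a b]; ring
  have e4 : ∑ c, Γ c a c = ∑ d, Γ d d a := Finset.sum_congr rfl fun c _ => hΓ _ _ _
  have e5 : ∑ c, p c * Γ c a b = ∑ c, Γ c a b * p c :=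
    Finset.sum_congr rfl fun c _ => mul_comm _ _
  rw [e1, e2, e3, e4, e5]
  ring

end ConfDiff

section PartialDerivatives

variable {n : ℕ} {f h : Pt n → ℝ} {x : Pt n}

lemma pd_congr (a : Fin n) (hfh : ∀ᶠ y in nhds x, f y = h y) : pd a f x = pd a h x := by
  have : f =ᶠ[nhds x] h := hfh
  rw [pd, pd, this.fderiv_eq]

lemma pd_const (a : Fin n) (r : ℝ) : pd a (fun _ => r) x = 0 := by
  simp [pd]

lemma pd_add (a : Fin n) (hf : DifferentiableAt ℝ f x) (hh : DifferentiableAt ℝ h x) :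
    pd a (fun y => f y + h y) x = pd a f x + pd a h x := by
  simp [pd, fderiv_fun_add hf hh]

lemma pd_sub (a : Fin n) (hf : DifferentiableAt ℝ f x) (hh : DifferentiableAt ℝ h x) :
    pd a (fun y => f y - h y) x = pd a f x - pd a h x := by
  simp [pd, fderiv_fun_sub hf hh]

lemma pd_mul (a : Fin n) (hf : DifferentiableAt ℝ f x) (hh : DifferentiableAt ℝ h x) :
    pd a (fun y => f y * h y) x = pd a f x * h x + f x * pd a h x := by
  simp [pd, fderiv_fun_mul hf hh]
  ring

lemma pd_sum {ι : Type*} (s : Finset ι) {F : ι → Pt n → ℝ} (a : Fin n)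
    (hF : ∀ i ∈ s, DifferentiableAt ℝ (F i) x) :
    pd a (fun y => ∑ i ∈ s, F i y) x = ∑ i ∈ s, pd a (F i) x := by
  simp [pd, fderiv_fun_sum hF]

lemma pd_exp (a : Fin n) (hf : DifferentiableAt ℝ f x) :
    pd a (fun y => Real.exp (f y)) x = Real.exp (f x) * pd a f x := by
  simp [pd, fderiv_exp hf]

lemma pd_sqrt (a : Fin n) (hf : DifferentiableAt ℝ f x) (hx : f x ≠ 0) :
    pd a (fun y => Real.sqrt (f y)) x = 1 / (2 * Real.sqrt (f x)) * pd a f x := by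
  simp [pd, fderiv_sqrt hf hx]

lemma ContDiffAt.pd (a : Fin n) (hf : ContDiffAt ℝ 2 f x) : ContDiffAt ℝ 1 (pd a f) x := by
  have : ContDiffAt ℝ 1 (fderiv ℝ f) x := hf.fderiv_right (by norm_num)
  exact this.clm_apply contDiffAt_const

end PartialDerivatives

section Determinant

variable {n : ℕ}

/-- The determinant as a continuous multilinear map of the rows. -/
def detRows (n : ℕ) : ContinuousMultilinearMap ℝ (fun _ : Fin n => Fin n → ℝ) ℝ where
  toMultilinearMap := (Matrix.detRowAlternating (R := ℝ) (n := Fin n)).toMultilinearMap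
  cont := Continuous.matrix_det (A := fun M : Matrix (Fin n) (Fin n) ℝ => M) continuous_id

variable {g : Met n} {x : Pt n}

lemma contDiffAt_det {m : WithTop ℕ∞} (hg : ∀ a b, ContDiffAt ℝ m (fun y => g y a b) x) :
    ContDiffAt ℝ m (fun y => (g y).det) x :=
  (detRows n).contDiff.contDiffAt.comp (f := fun y i j => g y i j) x
    (contDiffAt_pi.2 fun a => contDiffAt_pi.2 fun b => hg a b)

/-- Jacobi's formula for the derivative of the determinant. -/
lemma pd_det (a : Fin n) (hg : ∀ a b, DifferentiableAt ℝ (fun y => g y a b) x) :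
    pd a (fun y => (g y).det) x
      = ∑ i, ∑ j, (g x).adjugate j i * pd a (fun y => g y i j) x := by
  have hG : HasFDerivAt (fun y i j => g y i j)
      (ContinuousLinearMap.pi fun i => ContinuousLinearMap.pi fun j =>
        fderiv ℝ (fun y => g y i j) x) x :=
    hasFDerivAt_pi.2 fun i => hasFDerivAt_pi.2 fun j => (hg i j).hasFDerivAt
  have h := ((detRows n).hasFDerivAt (g x)).comp x hG
  have h' : fderiv ℝ (fun y => (g y).det) x = _ := h.fderiv
  rw [pd, h']
  rw [ContinuousLinearMap.comp_apply]
  refine ((detRows n).linearDeriv_apply _ _).trans ?_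
  refine Finset.sum_congr rfl fun i _ => ?_
  change ((g x).updateRow i fun j => pd a (fun y => g y i j) x).det = _
  rw [← Matrix.cramer_transpose_apply, Matrix.cramer_eq_adjugate_mulVec,
    ← Matrix.adjugate_transpose]
  rfl

lemma contDiffAt_matrix_inv {m : WithTop ℕ∞} (hg : ∀ a b, ContDiffAt ℝ m (fun y => g y a b) x)
    (hdet : (g x).det ≠ 0) (a b : Fin n) : ContDiffAt ℝ m (fun y => (g y)⁻¹ a b) x := by
  have : (fun y => (g y)⁻¹ a b)
      = fun y => ((g y).det)⁻¹ * ((g y).updateRow b (Pi.single a 1)).det := by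
    ext y
    rw [Matrix.inv_def, Matrix.smul_apply, Matrix.adjugate_apply, Ring.inverse_eq_inv', smul_eq_mul]
  rw [this]
  refine ((contDiffAt_det hg).inv hdet).mul (contDiffAt_det fun i j => ?_)
  by_cases hi : i = b
  · subst hi
    simpa using contDiffAt_const
  · simpa [hi] using hg i j

end Determinant

section Metric

variable {n : ℕ} {g : Met n} {U : Set (Pt n)} {x : Pt n}

lemma IsMetricOn.apply_comm (hgm : IsMetricOn g U) (hx : x ∈ U) (a b : Fin n) :
    g x a b = g x b a :=
  (hgm x hx).1.apply b a

lemma IsMetricOn.det_pos (hgm : IsMetricOn g U) (hx : x ∈ U) : 0 < (g x).det :=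
  (hgm x hx).2.det_pos

lemma IsMetricOn.inv_apply_comm (hgm : IsMetricOn g U) (hx : x ∈ U) (a b : Fin n) :
    (g x)⁻¹ a b = (g x)⁻¹ b a := by
  have h : (g x)⁻¹ᵀ = (g x)⁻¹ := by rw [Matrix.transpose_nonsing_inv, (hgm x hx).1]
  exact congrFun (congrFun h b) a

lemma IsMetricOn.sum_inv_mul (hgm : IsMetricOn g U) (hx : x ∈ U) (a c : Fin n) :
    ∑ b, (g x)⁻¹ a b * g x b c = if a = c then 1 else 0 := by
  have h := Matrix.nonsing_inv_mul (g x) (hgm.det_pos hx).ne'.isUnit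
  simpa [Matrix.mul_apply, Matrix.one_apply] using congrFun (congrFun h a) c

/-- Lowering an index after raising it. -/
lemma IsMetricOn.sum_mul_sum_inv_mul (hgm : IsMetricOn g U) (hx : x ∈ U) (X : Fin n → ℝ)
    (a : Fin n) : ∑ b, g x a b * ∑ c, (g x)⁻¹ b c * X c = X a := by
  have h : g x *ᵥ ((g x)⁻¹ *ᵥ X) = X := by
    rw [Matrix.mulVec_mulVec, Matrix.mul_nonsing_inv _ (hgm.det_pos hx).ne'.isUnit,
      Matrix.one_mulVec]
  exact congrFun h a

/-- Raising an index after lowering it. -/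
lemma IsMetricOn.sum_inv_mul_sum_mul (hgm : IsMetricOn g U) (hx : x ∈ U) (X : Fin n → ℝ)
    (a : Fin n) : ∑ b, (g x)⁻¹ a b * ∑ c, g x b c * X c = X a := by
  have h : (g x)⁻¹ *ᵥ (g x *ᵥ X) = X := by
    rw [Matrix.mulVec_mulVec, Matrix.nonsing_inv_mul _ (hgm.det_pos hx).ne'.isUnit,
      Matrix.one_mulVec]
  exact congrFun h a

lemma IsMetricOn.sum_sum_inv_mul (hgm : IsMetricOn g U) (hx : x ∈ U) :
    ∑ a, ∑ b, (g x)⁻¹ a b * g x a b = n := by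
  have (a : Fin n) : ∑ b, (g x)⁻¹ a b * g x a b = 1 := by
    simpa [hgm.apply_comm hx a] using hgm.sum_inv_mul hx a a
  simp [this]

lemma IsMetricOn.pd_comm (hgm : IsMetricOn g U) (hU : IsOpen U) (hx : x ∈ U) (e a b : Fin n) :
    pd e (fun y => g y a b) x = pd e (fun y => g y b a) x :=
  pd_congr e (Filter.eventually_of_mem (hU.mem_nhds hx) fun _ hy => hgm.apply_comm hy a b)

lemma christoffel_comm (hgm : IsMetricOn g U) (hU : IsOpen U) (hx : x ∈ U) (c a b : Fin n) :
    christoffel g c a b x = christoffel g c b a x := by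
  simp only [christoffel, hgm.pd_comm hU hx _ a b]
  congr 1
  exact Finset.sum_congr rfl fun _ _ => by ring

lemma sum_mul_christoffel (hgm : IsMetricOn g U) (hx : x ∈ U) (e a b : Fin n) :
    ∑ c, g x e c * christoffel g c a b x
      = (1 / 2) * (pd a (fun y => g y b e) x + pd b (fun y => g y a e) x
        - pd e (fun y => g y a b) x) := by
  simp only [christoffel]
  rw [← hgm.sum_mul_sum_inv_mul hx (fun d => pd a (fun y => g y b d) x
    + pd b (fun y => g y a d) x - pd d (fun y => g y a b) x) e, Finset.mul_sum]
  exact Finset.sum_congr rfl fun _ _ => by ring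

/-- The Levi-Civita connection is compatible with the metric. -/
lemma metric_compatibility (hgm : IsMetricOn g U) (hU : IsOpen U) (hx : x ∈ U)
    (d a b : Fin n) :
    ∑ c, g x c b * christoffel g c a d x + ∑ c, g x c a * christoffel g c d b x
      = pd d (fun y => g y a b) x := by
  simp only [hgm.apply_comm hx _ b, hgm.apply_comm hx _ a]
  rw [sum_mul_christoffel hgm hx, sum_mul_christoffel hgm hx, hgm.pd_comm hU hx d b a,
    hgm.pd_comm hU hx a d b, hgm.pd_comm hU hx b d a]
  ring

lemma sum_christoffel_self (hgm : IsMetricOn g U) (hU : IsOpen U) (hx : x ∈ U) (a : Fin n) :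
    ∑ c, christoffel g c c a x
      = (1 / 2) * ∑ c, ∑ d, (g x)⁻¹ c d * pd a (fun y => g y c d) x := by
  simp only [christoffel, ← Finset.mul_sum]
  congr 1
  simp only [mul_sub, mul_add, Finset.sum_add_distrib, Finset.sum_sub_distrib]
  have : ∑ c, ∑ d, (g x)⁻¹ c d * pd d (fun y => g y c a) x
      = ∑ c, ∑ d, (g x)⁻¹ c d * pd c (fun y => g y a d) x := by
    rw [Finset.sum_comm]
    exact Finset.sum_congr rfl fun _ _ => Finset.sum_congr rfl fun _ _ => by
      rw [hgm.inv_apply_comm hx, hgm.pd_comm hU hx]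
  rw [this]
  ring

variable (hg : ∀ a b, ContDiffOn ℝ 2 (fun y => g y a b) U)

include hg in
lemma pd_sqrt_det (hgm : IsMetricOn g U) (hU : IsOpen U) (hx : x ∈ U) (a : Fin n) :
    pd a (fun y => Real.sqrt (g y).det) x
      = Real.sqrt (g x).det * ∑ c, christoffel g c c a x := by
  have hd := hgm.det_pos hx
  have hgx (a b) : ContDiffAt ℝ 2 (fun y => g y a b) x := (hg a b).contDiffAt (hU.mem_nhds hx)
  rw [pd_sqrt a ((contDiffAt_det hgx).differentiableAt (by norm_num)) hd.ne',
    pd_det a fun i j => (hgx i j).differentiableAt (by norm_num), sum_christoffel_self hgm hU hx]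
  have h : ∑ i, ∑ j, (g x).adjugate j i * pd a (fun y => g y i j) x
      = (g x).det * ∑ c, ∑ d, (g x)⁻¹ c d * pd a (fun y => g y c d) x := by
    simp_rw [Finset.mul_sum]
    refine Finset.sum_congr rfl fun i _ => Finset.sum_congr rfl fun j _ => ?_
    rw [hgm.inv_apply_comm hx, Matrix.inv_def, Matrix.smul_apply, Ring.inverse_eq_inv',
      smul_eq_mul, ← mul_assoc, mul_inv_cancel_left₀ hd.ne']
  rw [h]
  have hs := Real.sqrt_pos.2 hd
  field_simp
  rw [Real.sq_sqrt hd.le]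

include hg in
/-- The inverse metric is parallel. -/
lemma pd_inv (hgm : IsMetricOn g U) (hU : IsOpen U) (hx : x ∈ U) (e a b : Fin n) :
    pd e (fun y => (g y)⁻¹ a b) x
      = -(∑ p, (g x)⁻¹ a p * christoffel g b p e x)
        - ∑ q, (g x)⁻¹ q b * christoffel g a q e x := by
  have hd := hgm.det_pos hx
  have hgx (a b) : ContDiffAt ℝ 2 (fun y => g y a b) x := (hg a b).contDiffAt (hU.mem_nhds hx)
  have hgd (a b) : DifferentiableAt ℝ (fun y => g y a b) x :=
    (hgx a b).differentiableAt (by norm_num)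
  have hGd (a b) : DifferentiableAt ℝ (fun y => (g y)⁻¹ a b) x :=
    (contDiffAt_matrix_inv hgx hd.ne' a b).differentiableAt (by norm_num)
  have key (c : Fin n) : ∑ q, pd e (fun y => (g y)⁻¹ a q) x * g x q c
      = -∑ q, (g x)⁻¹ a q * pd e (fun y => g y q c) x := by
    have h0 : pd e (fun y => ∑ q, (g y)⁻¹ a q * g y q c) x = 0 := by
      rw [← pd_const e (if a = c then (1 : ℝ) else 0) (x := x)]
      exact pd_congr e (Filter.eventually_of_mem (hU.mem_nhds hx) fun y hy =>
        hgm.sum_inv_mul hy a c)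
    rw [pd_sum _ _ fun q _ => (hGd a q).fun_mul (hgd q c)] at h0
    simp_rw [pd_mul e (hGd a _) (hgd _ c)] at h0
    rw [Finset.sum_add_distrib] at h0
    linarith
  have h1 (c : Fin n) : ∑ q, (g x)⁻¹ a q * pd e (fun y => g y q c) x
      = ∑ p, g x c p * (∑ q, (g x)⁻¹ a q * christoffel g p q e x)
        + christoffel g a c e x := by
    simp_rw [← metric_compatibility hgm hU hx e _ c, mul_add, Finset.sum_add_distrib]
    congr 1
    · simp_rw [Finset.mul_sum]
      rw [Finset.sum_comm]
      exact Finset.sum_congr rfl fun _ _ => Finset.sum_congr rfl fun _ _ => by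
        rw [hgm.apply_comm hx]; ring
    · simp_rw [hgm.apply_comm hx _ (_ : Fin n), christoffel_comm hgm hU hx _ e c]
      rw [hgm.sum_inv_mul_sum_mul hx (fun p => christoffel g p c e x)]
  have h2 := hgm.sum_inv_mul_sum_mul hx (fun q => pd e (fun y => (g y)⁻¹ a q) x) b
  have h3 (c : Fin n) : ∑ q, g x c q * pd e (fun y => (g y)⁻¹ a q) x
      = -(∑ p, g x c p * (∑ q, (g x)⁻¹ a q * christoffel g p q e x))
        - christoffel g a c e x := by
    have : ∑ q, g x c q * pd e (fun y => (g y)⁻¹ a q) x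
        = ∑ q, pd e (fun y => (g y)⁻¹ a q) x * g x q c :=
      Finset.sum_congr rfl fun q _ => by rw [hgm.apply_comm hx c, mul_comm]
    rw [this, key, h1]
    ring
  rw [← h2]
  simp_rw [h3, mul_sub, mul_neg, Finset.sum_sub_distrib, Finset.sum_neg_distrib]
  rw [hgm.sum_inv_mul_sum_mul hx (fun p => ∑ q, (g x)⁻¹ a q * christoffel g p q e x)]
  simp_rw [hgm.inv_apply_comm hx b]

include hg in
lemma sum_pd_inv (hgm : IsMetricOn g U) (hU : IsOpen U) (hx : x ∈ U) (b : Fin n) :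
    ∑ a, pd a (fun y => (g y)⁻¹ a b) x
      = -gammaUp g b x - ∑ c, (g x)⁻¹ c b * ∑ d, christoffel g d d c x := by
  simp_rw [pd_inv hg hgm hU hx, Finset.sum_sub_distrib, Finset.sum_neg_distrib]
  congr 1
  · rw [gammaUp]
    congr 1
    exact Finset.sum_congr rfl fun _ _ => Finset.sum_congr rfl fun _ _ => by
      rw [christoffel_comm hgm hU hx]
  · simp_rw [Finset.mul_sum]
    rw [Finset.sum_comm]
    exact Finset.sum_congr rfl fun _ _ => Finset.sum_congr rfl fun _ _ => by
      rw [christoffel_comm hgm hU hx]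

end Metric

/-- The gradient of `φ` with respect to `g`. -/
def grad {n : ℕ} (g : Met n) (φ : Pt n → ℝ) (e : Fin n) (x : Pt n) : ℝ :=
  ∑ d, (g x)⁻¹ e d * pd d φ x

/-- The squared length of the differential of `φ` with respect to `g`. -/
def gradSq {n : ℕ} (g : Met n) (φ : Pt n → ℝ) (x : Pt n) : ℝ :=
  ∑ e, grad g φ e x * pd e φ x

/-- The divergence of the gradient of `φ` with respect to `g`. -/
def divGrad {n : ℕ} (g : Met n) (φ : Pt n → ℝ) (x : Pt n) : ℝ :=
  ∑ e, pd e (grad g φ e) x + ∑ e, grad g φ e x * ∑ d, christoffel g d d e x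

section Conformal

variable {n : ℕ} {g : Met n} {U : Set (Pt n)} {x : Pt n} {φ c : Pt n → ℝ}

lemma contDiffAt_grad (hg : ∀ a b, ContDiffAt ℝ 2 (fun y => g y a b) x)
    (hdet : (g x).det ≠ 0) (hφ : ContDiffAt ℝ 2 φ x) (e : Fin n) :
    ContDiffAt ℝ 1 (grad g φ e) x :=
  ContDiffAt.sum fun d _ =>
    ((contDiffAt_matrix_inv hg hdet e d).of_le (by norm_num)).mul (hφ.pd d)

lemma contDiffAt_christoffel (hg : ∀ a b, ContDiffAt ℝ 2 (fun y => g y a b) x)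
    (hdet : (g x).det ≠ 0) (e a b : Fin n) : ContDiffAt ℝ 1 (christoffel g e a b) x :=
  contDiffAt_const.mul <| ContDiffAt.sum fun d _ =>
    ((contDiffAt_matrix_inv hg hdet e d).of_le (by norm_num)).mul
      ((((hg b d).pd a).add ((hg a d).pd b)).sub ((hg a b).pd d))

variable (hU : IsOpen U) (hgm : IsMetricOn g U)
  (hg : ∀ a b, ContDiffOn ℝ 2 (fun y => g y a b) U) (hφ : ContDiffOn ℝ 2 φ U)
  (hc : ∀ y ∈ U, c y = Real.exp (2 * φ y))

include hgm in
lemma sum_mul_grad (hx : x ∈ U) (a : Fin n) : ∑ b, g x a b * grad g φ b x = pd a φ x :=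
  hgm.sum_mul_sum_inv_mul hx (fun d => pd d φ x) a

include hU hgm hg hφ in
/-- The divergence of the gradient is the trace of the covariant Hessian. -/
lemma divGrad_eq (hx : x ∈ U) :
    divGrad g φ x = ∑ a, ∑ b, (g x)⁻¹ a b * pd a (pd b φ) x - ∑ e, gammaUp g e x * pd e φ x := by
  have hgx (a b) : ContDiffAt ℝ 2 (fun y => g y a b) x := (hg a b).contDiffAt (hU.mem_nhds hx)
  have hGd (a b) : DifferentiableAt ℝ (fun y => (g y)⁻¹ a b) x :=
    (contDiffAt_matrix_inv hgx (hgm.det_pos hx).ne' a b).differentiableAt (by norm_num)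
  have hpd (b) : DifferentiableAt ℝ (pd b φ) x :=
    ((hφ.contDiffAt (hU.mem_nhds hx)).pd b).differentiableAt (by norm_num)
  have h1 (e : Fin n) : pd e (grad g φ e) x
      = ∑ d, pd e (fun y => (g y)⁻¹ e d) x * pd d φ x + ∑ d, (g x)⁻¹ e d * pd e (pd d φ) x := by
    have : grad g φ e = fun y => ∑ d, (g y)⁻¹ e d * pd d φ y := rfl
    rw [this, pd_sum _ _ fun d _ => (hGd e d).fun_mul (hpd d), ← Finset.sum_add_distrib]
    exact Finset.sum_congr rfl fun d _ => pd_mul e (hGd e d) (hpd d)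
  have h2 : ∑ e, ∑ d, pd e (fun y => (g y)⁻¹ e d) x * pd d φ x
      = -(∑ e, gammaUp g e x * pd e φ x) - ∑ e, grad g φ e x * ∑ d, christoffel g d d e x := by
    rw [Finset.sum_comm]
    simp_rw [← Finset.sum_mul, sum_pd_inv hg hgm hU hx, sub_mul, neg_mul, Finset.sum_sub_distrib,
      Finset.sum_neg_distrib]
    congr 1
    simp_rw [grad, Finset.sum_mul]
    rw [Finset.sum_comm]
    exact Finset.sum_congr rfl fun _ _ => Finset.sum_congr rfl fun _ _ => by ring
  rw [divGrad]
  simp_rw [h1, Finset.sum_add_distrib]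
  rw [h2]
  ring

include hU hgm hg hφ in
lemma sum_pd_sqrt_det_mul_grad (hx : x ∈ U) :
    ∑ a, pd a (fun y => Real.sqrt (g y).det * grad g φ a y) x
      = Real.sqrt (g x).det * divGrad g φ x := by
  have hgx (a b) : ContDiffAt ℝ 2 (fun y => g y a b) x := (hg a b).contDiffAt (hU.mem_nhds hx)
  have hd := (hgm.det_pos hx).ne'
  have hgr (e) : DifferentiableAt ℝ (grad g φ e) x :=
    (contDiffAt_grad hgx hd (hφ.contDiffAt (hU.mem_nhds hx)) e).differentiableAt (by norm_num)
  have hs : DifferentiableAt ℝ (fun y => Real.sqrt (g y).det) x :=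
    ((contDiffAt_det hgx).sqrt hd).differentiableAt (by norm_num)
  simp_rw [pd_mul _ hs (hgr _), pd_sqrt_det hg hgm hU hx, divGrad, mul_add, Finset.mul_sum,
    Finset.sum_add_distrib]
  rw [add_comm]
  congr 1
  exact Finset.sum_congr rfl fun _ _ => by
    rw [Finset.sum_mul]; exact Finset.sum_congr rfl fun _ _ => by ring

include hc in
lemma conf_inv_apply (hgm : IsMetricOn g U) (hx : x ∈ U) (a b : Fin n) :
    (c x • g x)⁻¹ a b = (c x)⁻¹ * (g x)⁻¹ a b := by
  have h0 : c x ≠ 0 := by rw [hc x hx]; positivity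
  have := invertibleOfNonzero h0
  rw [Matrix.inv_smul _ _ (hgm.det_pos hx).ne'.isUnit, invOf_eq_inv]
  rfl

include hU hg hφ hc in
lemma pd_conf (hx : x ∈ U) (e a b : Fin n) :
    pd e (fun y => (c y • g y) a b) x
      = c x * (2 * pd e φ x * g x a b + pd e (fun y => g y a b) x) := by
  have hgd : DifferentiableAt ℝ (fun y => g y a b) x :=
    ((hg a b).contDiffAt (hU.mem_nhds hx)).differentiableAt (by norm_num)
  have hφd : DifferentiableAt ℝ φ x :=
    (hφ.contDiffAt (hU.mem_nhds hx)).differentiableAt (by norm_num)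
  have h : ∀ᶠ y in nhds x, (c y • g y) a b = Real.exp (2 * φ y) * g y a b :=
    Filter.eventually_of_mem (hU.mem_nhds hx) fun y hy => by
      rw [Matrix.smul_apply, hc y hy, smul_eq_mul]
  rw [pd_congr e h, pd_mul e (hφd.const_mul 2).exp hgd, pd_exp e (hφd.const_mul 2),
    pd_mul e (differentiableAt_const 2) hφd, pd_const, hc x hx]
  ring

include hU hgm hg hφ hc in
/-- Conformal transformation law of the Christoffel symbols. -/
lemma christoffel_conf (hx : x ∈ U) (e a b : Fin n) :
    christoffel (fun y => c y • g y) e a b x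
      = christoffel g e a b x
        + confDiff (g x) (fun d => pd d φ x) (fun d => grad g φ d x) e a b := by
  have h0 : c x ≠ 0 := by rw [hc x hx]; positivity
  simp only [christoffel]
  have h (d : Fin n) : (c x • g x)⁻¹ e d * (pd a (fun y => (c y • g y) b d) x
      + pd b (fun y => (c y • g y) a d) x - pd d (fun y => (c y • g y) a b) x)
      = (g x)⁻¹ e d * (pd a (fun y => g y b d) x + pd b (fun y => g y a d) x
          - pd d (fun y => g y a b) x)
        + 2 * (pd a φ x * ((g x)⁻¹ e d * g x d b) + pd b φ x * ((g x)⁻¹ e d * g x d a)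
          - g x a b * ((g x)⁻¹ e d * pd d φ x)) := by
    rw [conf_inv_apply hc hgm hx]
    simp only [pd_conf hU hg hφ hc hx]
    rw [hgm.apply_comm hx d b, hgm.apply_comm hx d a]
    field_simp
    ring
  simp_rw [h, Finset.sum_add_distrib, ← Finset.mul_sum, Finset.sum_sub_distrib,
    Finset.sum_add_distrib, ← Finset.mul_sum, hgm.sum_inv_mul hx]
  simp only [confDiff, grad, mul_ite, mul_one, mul_zero]
  ring

include hU hgm hg hφ hc in
/-- Conformal transformation law of the contracted Christoffel symbols. -/
lemma gammaLow_conf (hx : x ∈ U) (a : Fin n) :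
    gammaLow (fun y => c y • g y) a x = gammaLow g a x - (n - 2) * pd a φ x := by
  have h0 : c x ≠ 0 := by rw [hc x hx]; positivity
  have hup (b : Fin n) : gammaUp (fun y => c y • g y) b x
      = (c x)⁻¹ * (gammaUp g b x - (n - 2) * grad g φ b x) := by
    simp only [gammaUp]
    have h (i j : Fin n) : (c x • g x)⁻¹ i j * christoffel (fun y => c y • g y) b i j x
        = (c x)⁻¹ * ((g x)⁻¹ i j * christoffel g b i j x
          + (if b = i then (g x)⁻¹ i j * pd j φ x else 0)
          + (if b = j then (g x)⁻¹ i j * pd i φ x else 0)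
          - (g x)⁻¹ i j * g x i j * grad g φ b x) := by
      rw [conf_inv_apply hc hgm hx, christoffel_conf hU hgm hg hφ hc hx, confDiff]
      split_ifs <;> ring
    have h' : ∑ i, (g x)⁻¹ i b * pd i φ x = grad g φ b x := by
      rw [grad]
      exact Finset.sum_congr rfl fun i _ => by rw [hgm.inv_apply_comm hx]
    have h'' : ∑ i, ∑ j, (if b = i then (g x)⁻¹ i j * pd j φ x else 0) = grad g φ b x := by
      rw [Finset.sum_comm]; simp [grad]
    simp_rw [h, ← Finset.mul_sum, Finset.sum_sub_distrib, Finset.sum_add_distrib,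
      ← Finset.sum_mul, hgm.sum_sum_inv_mul hx, h'']
    simp only [Finset.sum_ite_eq, Finset.mem_univ, if_true, h']
    ring
  simp only [gammaLow, hup]
  have h (b : Fin n) : (c x • g x) a b * ((c x)⁻¹ * (gammaUp g b x - (n - 2) * grad g φ b x))
      = g x a b * gammaUp g b x - (n - 2) * (g x a b * grad g φ b x) := by
    rw [Matrix.smul_apply, smul_eq_mul]
    field_simp
  simp_rw [h, Finset.sum_sub_distrib, ← Finset.mul_sum, sum_mul_grad hgm hx]

include hU hgm hg hφ hc in
/-- Conformal transformation law of the Ricci tensor. -/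
lemma ricci_conf (hx : x ∈ U) (a b : Fin n) :
    ricci (fun y => c y • g y) a b x
      = ricci g a b x + pd a (pd b φ) x + pd b (pd a φ) x - n * pd a (pd b φ) x
        + (n - 2) * ∑ e, christoffel g e a b x * pd e φ x
        + (n - 2) * (pd a φ x * pd b φ x)
        - (n - 2) * (g x a b * gradSq g φ x) - g x a b * divGrad g φ x := by
  have hgx (a b) : ContDiffAt ℝ 2 (fun y => g y a b) x := (hg a b).contDiffAt (hU.mem_nhds hx)
  have hd := (hgm.det_pos hx).ne'
  have hφx := hφ.contDiffAt (hU.mem_nhds hx)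
  have hgd (a b) : DifferentiableAt ℝ (fun y => g y a b) x :=
    (hgx a b).differentiableAt (by norm_num)
  have hgr (e) : DifferentiableAt ℝ (grad g φ e) x :=
    (contDiffAt_grad hgx hd hφx e).differentiableAt (by norm_num)
  have hpd (b) : DifferentiableAt ℝ (pd b φ) x := (hφx.pd b).differentiableAt (by norm_num)
  have hch (e a b) : DifferentiableAt ℝ (christoffel g e a b) x :=
    (contDiffAt_christoffel hgx hd e a b).differentiableAt (by norm_num)
  set T : Fin n → Fin n → Fin n → Pt n → ℝ := fun e a b y =>
    confDiff (g y) (fun d => pd d φ y) (fun d => grad g φ d y) e a b with hT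
  have hite (p : Prop) [Decidable p] (d : Fin n) :
      DifferentiableAt ℝ (fun y => if p then pd d φ y else 0) x := by
    split_ifs
    exacts [hpd d, differentiableAt_const _]
  have hpdite (p : Prop) [Decidable p] (e d : Fin n) :
      pd e (fun y => if p then pd d φ y else 0) x = if p then pd e (pd d φ) x else 0 := by
    split_ifs
    exacts [rfl, pd_const _ _]
  have hTd (e a b) : DifferentiableAt ℝ (T e a b) x :=
    ((hite _ _).add (hite _ _)).sub ((hgd a b).mul (hgr e))
  have hpdch (d e a b) : pd d (christoffel (fun y => c y • g y) e a b) x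
      = pd d (christoffel g e a b) x + pd d (T e a b) x := by
    rw [← pd_add d (hch e a b) (hTd e a b)]
    exact pd_congr d (Filter.eventually_of_mem (hU.mem_nhds hx) fun y hy =>
      christoffel_conf hU hgm hg hφ hc hy e a b)
  have hdiv : ∑ e, pd e (T e a b) x = pd a (pd b φ) x + pd b (pd a φ) x
      - ∑ e, pd e (fun y => g y a b) x * grad g φ e x
      - g x a b * ∑ e, pd e (grad g φ e) x := by
    have (e : Fin n) : pd e (T e a b) x = (if e = a then pd e (pd b φ) x else 0)
        + (if e = b then pd e (pd a φ) x else 0)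
        - (pd e (fun y => g y a b) x * grad g φ e x + g x a b * pd e (grad g φ e) x) := by
      rw [← pd_mul e (hgd a b) (hgr e), ← hpdite, ← hpdite, ← pd_add e (hite _ _) (hite _ _),
        ← pd_sub e ((hite _ _).fun_add (hite _ _)) ((hgd a b).fun_mul (hgr e))]
      rfl
    simp_rw [this, Finset.sum_sub_distrib, Finset.sum_add_distrib, Finset.mul_sum]
    simp
    ring
  have htr : ∑ e, pd a (T e e b) x = n * pd a (pd b φ) x := by
    have h : ∀ᶠ y in nhds x, ∑ e, T e e b y = n * pd b φ y :=
      Filter.eventually_of_mem (hU.mem_nhds hx) fun y hy =>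
        sum_confDiff_self (hgm.apply_comm hy) (sum_mul_grad hgm hy) b
    rw [← pd_sum _ _ fun e _ => hTd e e b, pd_congr a h,
      pd_mul a (differentiableAt_const _) (hpd b), pd_const]
    ring
  have hquad := quadratic_ricci_confDiff (hgm.apply_comm hx) (sum_mul_grad (φ := φ) hgm hx)
    (christoffel_comm hgm hU hx) (metric_compatibility hgm hU hx) a b
  simp only [← christoffel_conf hU hgm hg hφ hc hx] at hquad
  simp only [ricci, hpdch, Finset.sum_add_distrib, hdiv, htr, divGrad, gradSq]
  linear_combination hquad

include hU hgm hg hφ hc in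
/-- Conformal transformation law of the scalar curvature. -/
lemma scalarCurv_conf (hx : x ∈ U) :
    scalarCurv (fun y => c y • g y) x
      = (c x)⁻¹ * (scalarCurv g x - 2 * (n - 1) * divGrad g φ x
        - (n - 1) * (n - 2) * gradSq g φ x) := by
  have hH := divGrad_eq hU hgm hg hφ hx
  have h (a b : Fin n) : (c x • g x)⁻¹ a b * ricci (fun y => c y • g y) a b x
      = (c x)⁻¹ * ((g x)⁻¹ a b * ricci g a b x
        + (1 - n) * ((g x)⁻¹ a b * pd a (pd b φ) x) + (g x)⁻¹ b a * pd b (pd a φ) x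
        + (n - 2) * ∑ e, (g x)⁻¹ a b * christoffel g e a b x * pd e φ x
        + (n - 2) * (pd a φ x * ((g x)⁻¹ a b * pd b φ x))
        - ((n - 2) * gradSq g φ x + divGrad g φ x) * ((g x)⁻¹ a b * g x a b)) := by
    rw [conf_inv_apply hc hgm hx, ricci_conf hU hgm hg hφ hc hx, hgm.inv_apply_comm hx b a]
    simp_rw [mul_assoc ((g x)⁻¹ a b), ← Finset.mul_sum]
    ring
  have hΓ : ∑ a, ∑ b, ∑ e, (g x)⁻¹ a b * christoffel g e a b x * pd e φ x
      = ∑ e, gammaUp g e x * pd e φ x := by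
    simp_rw [gammaUp, Finset.sum_mul]
    rw [Finset.sum_comm]
    refine (Finset.sum_congr rfl fun _ _ => Finset.sum_comm).trans ?_
    rw [Finset.sum_comm]
    exact Finset.sum_congr rfl fun _ _ => Finset.sum_comm
  have hsq : ∑ a, pd a φ x * ∑ b, (g x)⁻¹ a b * pd b φ x = gradSq g φ x :=
    Finset.sum_congr rfl fun a _ => mul_comm _ _
  have hsw : ∑ a, ∑ b, (g x)⁻¹ b a * pd b (pd a φ) x
      = ∑ a, ∑ b, (g x)⁻¹ a b * pd a (pd b φ) x := Finset.sum_comm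
  rw [scalarCurv]
  simp_rw [h, ← Finset.mul_sum, Finset.sum_sub_distrib, Finset.sum_add_distrib,
    ← Finset.mul_sum]
  rw [hsw, hsq, hΓ, hgm.sum_sum_inv_mul hx, scalarCurv]
  congr 1
  linear_combination (n - 2 : ℝ) * hH

variable {f v : Pt n → ℝ} (hf : ContDiffOn ℝ 2 f U)
  (hv : ∀ y ∈ U, v y = Real.exp (-(((n : ℝ) - 2) / 2 * φ y)) * f y)

include hU hgm hg hφ hc hf hv in
/-- Conformal transformation law of the Laplace–Beltrami operator. -/
lemma laplaceBeltrami_conf (hx : x ∈ U) :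
    laplaceBeltrami (fun y => c y • g y) v x
      = Real.exp (-(((n : ℝ) + 2) / 2 * φ x)) * (laplaceBeltrami g f x
        + (n - 2) / 2 * f x * divGrad g φ x + ((n - 2) / 2) ^ 2 * f x * gradSq g φ x) := by
  set m : ℝ := ((n : ℝ) - 2) / 2 with hm
  have hgx (a b) : ContDiffAt ℝ 2 (fun y => g y a b) x := (hg a b).contDiffAt (hU.mem_nhds hx)
  have hd := (hgm.det_pos hx).ne'
  have hφx := hφ.contDiffAt (hU.mem_nhds hx)
  have hfx := hf.contDiffAt (hU.mem_nhds hx)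
  have hφd {y} (hy : y ∈ U) : DifferentiableAt ℝ φ y :=
    (hφ.contDiffAt (hU.mem_nhds hy)).differentiableAt (by norm_num)
  have hfd {y} (hy : y ∈ U) : DifferentiableAt ℝ f y :=
    (hf.contDiffAt (hU.mem_nhds hy)).differentiableAt (by norm_num)
  have hs : DifferentiableAt ℝ (fun y => Real.sqrt (g y).det) x :=
    ((contDiffAt_det hgx).sqrt hd).differentiableAt (by norm_num)
  have hgr (e) : DifferentiableAt ℝ (grad g φ e) x :=
    (contDiffAt_grad hgx hd hφx e).differentiableAt (by norm_num)
  have hgf (e) : DifferentiableAt ℝ (grad g f e) x :=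
    (contDiffAt_grad hgx hd hfx e).differentiableAt (by norm_num)
  have hsqrt {y} (hy : y ∈ U) :
      Real.sqrt (c y • g y).det = Real.exp (n * φ y) * Real.sqrt (g y).det := by
    have : Real.exp (2 * φ y) ^ n = Real.exp (n * φ y) ^ 2 := by
      rw [← Real.exp_nat_mul, ← Real.exp_nat_mul]; push_cast; ring_nf
    rw [Matrix.det_smul, Fintype.card_fin, hc y hy, this, Real.sqrt_mul (sq_nonneg _),
      Real.sqrt_sq (Real.exp_nonneg _)]
  have hpdv {y} (hy : y ∈ U) (b : Fin n) :
      pd b v y = Real.exp (-(m * φ y)) * (pd b f y - m * f y * pd b φ y) := by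
    have hv' : ∀ z ∈ U, v z = Real.exp (-m * φ z) * f z := fun z hz => by
      rw [hv z hz, neg_mul]
    have hmφ := (hφd hy).const_mul (-m)
    rw [pd_congr b (Filter.eventually_of_mem (hU.mem_nhds hy) hv'), pd_mul b hmφ.exp (hfd hy),
      pd_exp b hmφ, pd_mul b (differentiableAt_const _) (hφd hy), pd_const, neg_mul]
    ring
  have hflux (a : Fin n) : ∀ᶠ y in nhds x,
      Real.sqrt (c y • g y).det * ∑ b, (c y • g y)⁻¹ a b * pd b v y
        = Real.exp (m * φ y) * (Real.sqrt (g y).det * grad g f a y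
          - m * f y * (Real.sqrt (g y).det * grad g φ a y)) := by
    refine Filter.eventually_of_mem (hU.mem_nhds hx) fun y hy => ?_
    have hexp : Real.exp (m * φ y)
        = Real.exp (n * φ y) * Real.exp (-(2 * φ y)) * Real.exp (-(m * φ y)) := by
      rw [← Real.exp_add, ← Real.exp_add, hm]; ring_nf
    have h (b : Fin n) : (c y • g y)⁻¹ a b * pd b v y
        = Real.exp (-(2 * φ y)) * Real.exp (-(m * φ y))
          * ((g y)⁻¹ a b * pd b f y - m * f y * ((g y)⁻¹ a b * pd b φ y)) := by
      rw [conf_inv_apply hc hgm hy, hpdv hy, hc y hy, Real.exp_neg (2 * φ y)]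
      ring
    simp_rw [h, ← Finset.mul_sum, Finset.sum_sub_distrib, ← Finset.mul_sum]
    rw [hsqrt hy, hexp, grad, grad]
    ring
  have hpdflux (a : Fin n) :
      pd a (fun y => Real.sqrt (c y • g y).det * ∑ b, (c y • g y)⁻¹ a b * pd b v y) x
        = Real.exp (m * φ x) * (pd a (fun y => Real.sqrt (g y).det * grad g f a y) x
          - m * f x * pd a (fun y => Real.sqrt (g y).det * grad g φ a y) x
          + m * Real.sqrt (g x).det * (pd a φ x * grad g f a x)
          - m * Real.sqrt (g x).det * (pd a f x * grad g φ a x)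
          - m ^ 2 * f x * Real.sqrt (g x).det * (grad g φ a x * pd a φ x)) := by
    have hmf := (hfd hx).const_mul m
    have hmφ := (hφd hx).const_mul m
    rw [pd_congr a (hflux a), pd_mul a hmφ.exp
        ((hs.fun_mul (hgf a)).fun_sub (hmf.fun_mul (hs.fun_mul (hgr a)))),
      pd_sub a (hs.fun_mul (hgf a)) (hmf.fun_mul (hs.fun_mul (hgr a))),
      pd_mul a hmf (hs.fun_mul (hgr a)), pd_exp a hmφ,
      pd_mul a (differentiableAt_const m) (hφd hx), pd_mul a (differentiableAt_const m) (hfd hx),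
      pd_const]
    ring
  have hcross : ∑ a, pd a φ x * grad g f a x = ∑ a, pd a f x * grad g φ a x := by
    simp_rw [grad, Finset.mul_sum]
    rw [Finset.sum_comm]
    exact Finset.sum_congr rfl fun _ _ => Finset.sum_congr rfl fun _ _ => by
      rw [hgm.inv_apply_comm hx]; ring
  have hsum := sum_pd_sqrt_det_mul_grad hU hgm hg hφ hx
  have hexp : Real.exp (-(((n : ℝ) + 2) / 2 * φ x))
      = (Real.exp (n * φ x))⁻¹ * Real.exp (m * φ x) := by
    rw [← Real.exp_neg, ← Real.exp_add, hm]; ring_nf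
  have hspos := Real.sqrt_pos.2 (hgm.det_pos hx)
  rw [laplaceBeltrami, laplaceBeltrami]
  simp_rw [hpdflux, ← Finset.mul_sum, Finset.sum_sub_distrib, Finset.sum_add_distrib,
    Finset.sum_sub_distrib, ← Finset.mul_sum]
  rw [hsum, hcross, hsqrt hx, hexp, ← gradSq]
  have hgrad (a : Fin n) (y : Pt n) : ∑ b, (g y)⁻¹ a b * pd b f y = grad g f a y := rfl
  simp only [hgrad]
  field_simp
  ring

include hU hgm hg hφ hc hf hv in
/-- Conformal covariance of the conformal Laplacian. -/
lemma confLap_conf (hn : (n : ℝ) ≠ 1) (hx : x ∈ U) :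
    confLap (fun y => c y • g y) v x
      = Real.exp (-(((n : ℝ) + 2) / 2 * φ x)) * confLap g f x := by
  have hexp : Real.exp (-(((n : ℝ) + 2) / 2 * φ x))
      = (Real.exp (2 * φ x))⁻¹ * Real.exp (-(((n : ℝ) - 2) / 2 * φ x)) := by
    rw [← Real.exp_neg, ← Real.exp_add]; ring_nf
  rw [confLap, confLap, laplaceBeltrami_conf hU hgm hg hφ hc hf hv hx,
    scalarCurv_conf hU hgm hg hφ hc hx, hv x hx, hc x hx, hexp]
  have := sub_ne_zero.2 hn
  field_simp
  ring

end Conformal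

/-- Proposition 2.6: conformal invariance of the conformal harmonic gauge
condition. -/
theorem conformal_harmonic_gauge_conformally_invariant
    (n k : ℕ) (hn : 3 ≤ n) (hk : 2 ≤ k) (α : ℝ) (hα : α ∈ Set.Ioo (0 : ℝ) 1)
    (U : Set (Pt n)) (hU : IsOpen U)
    (g : Met n) (hgm : IsMetricOn g U) (hgr : MetCHolderOn k α U g)
    (c : Pt n → ℝ) (hc : ∀ x ∈ U, 0 < c x) (hcr : CHolderOn k α U c)
    (fg : Pt n → ℝ) (hfgreg : ContDiffOn ℝ 2 fg U) (hfgpos : ∀ x ∈ U, 0 < fg x)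
    (hLfg : ∀ x ∈ U, confLap g fg x = 0)
    (hgauge : ∀ a : Fin n, ∀ x ∈ U, gammaLow g a x = 2 * pd a (fun y => Real.log (fg y)) x) :
    (∀ x ∈ U, 0 < c x ^ (-((n : ℝ) - 2) / 4) * fg x) ∧
    (∀ x ∈ U,
      confLap (fun y => c y • g y) (fun y => c y ^ (-((n : ℝ) - 2) / 4) * fg y) x = 0) ∧
    (∀ a : Fin n, ∀ x ∈ U,
      gammaLow (fun y => c y • g y) a x
        = 2 * pd a (fun y => Real.log (c y ^ (-((n : ℝ) - 2) / 4) * fg y)) x) := by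
  have hg (a b) : ContDiffOn ℝ 2 (fun y => g y a b) U :=
    (hgr a b).1.of_le (by exact_mod_cast hk)
  have hc2 : ContDiffOn ℝ 2 c U := hcr.1.of_le (by exact_mod_cast hk)
  have hφ : ContDiffOn ℝ 2 (fun y => Real.log (c y) / 2) U :=
    (hc2.log fun y hy => (hc y hy).ne').div_const 2
  have hce : ∀ y ∈ U, c y = Real.exp (2 * (Real.log (c y) / 2)) := fun y hy => by
    rw [mul_div_cancel₀ _ two_ne_zero, Real.exp_log (hc y hy)]
  have hv : ∀ y ∈ U, c y ^ (-((n : ℝ) - 2) / 4) * fg y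
      = Real.exp (-(((n : ℝ) - 2) / 2 * (Real.log (c y) / 2))) * fg y := fun y hy => by
    rw [Real.rpow_def_of_pos (hc y hy)]
    ring_nf
  have hpos : ∀ x ∈ U, 0 < c x ^ (-((n : ℝ) - 2) / 4) * fg x := fun x hx =>
    mul_pos (Real.rpow_pos_of_pos (hc x hx) _) (hfgpos x hx)
  refine ⟨hpos, fun x hx => ?_, fun a x hx => ?_⟩
  · have hn1 : (n : ℝ) ≠ 1 := by
      exact_mod_cast (by omega : n ≠ 1)
    rw [confLap_conf hU hgm hg hφ hce hfgreg hv hn1 hx, hLfg x hx, mul_zero]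
  · have hφd : DifferentiableAt ℝ (fun y => Real.log (c y) / 2) x :=
      (hφ.contDiffAt (hU.mem_nhds hx)).differentiableAt (by norm_num)
    have hfd : DifferentiableAt ℝ (fun y => Real.log (fg y)) x :=
      ((hfgreg.contDiffAt (hU.mem_nhds hx)).differentiableAt (by norm_num)).log (hfgpos x hx).ne'
    have hlog : ∀ᶠ y in nhds x, Real.log (c y ^ (-((n : ℝ) - 2) / 4) * fg y)
        = -(((n : ℝ) - 2) / 2) * (Real.log (c y) / 2) + Real.log (fg y) :=
      Filter.eventually_of_mem (hU.mem_nhds hx) fun y hy => by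
        rw [hv y hy, Real.log_mul (Real.exp_ne_zero _) (hfgpos y hy).ne', Real.log_exp]
        ring
    rw [gammaLow_conf hU hgm hg hφ hce hx, hgauge a x hx, pd_congr a hlog,
      pd_add a (hφd.const_mul _) hfd, pd_mul a (differentiableAt_const _) hφd, pd_const]
    ring
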